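/- Let u ∈ L^∞(ℝ^d; ℝ^d), let x₀ ∈ ℝ^d, and suppose u admits the blow-up v(z) = u⁺ 1_{⟨z,ν⟩ ≥ 0}(z) + u⁻ 1_{⟨z,ν⟩ < 0}(z) at x₀ for some u⁺, u⁻ ∈ ℝ^d and unit vector ν (the case u⁺ = u⁻ is allowed). Let ρ ∈ K be a radial convolution kernel and write u_ℓ = u ∗ ρ_ℓ. Then lim_{ℓ→0⁺} ((u_ℓ ⊗ u_ℓ) ∗ ρ_ℓ)(x₀) = ∫_{B₁} [α_ν(y) u⁺ + (1 − α_ν(y)) u⁻] ⊗ [α_ν(y) u⁺ + (1 − α_ν(y)) u⁻] ρ(y) dy, where α_ν(y) := ∫_{B₁(y) ∩ {⟨z,ν⟩ ≥ 0}} ρ(y − z) dz. -/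

import Mathlib

open MeasureTheory Filter Metric Set
open scoped Topology RealInnerProductSpace

noncomputable section

/-- The class `K` of admissible convolution kernels: smooth, compactly supported in the open
unit ball, even, with unit mass. -/
structure IsKernel (d : ℕ) (ρ : EuclideanSpace ℝ (Fin d) → ℝ) : Prop where
  smooth : ContDiff ℝ (⊤ : ℕ∞) ρ
  supp : tsupport ρ ⊆ Metric.ball 0 1
  even : ∀ z, ρ (-z) = ρ z
  mass : (∫ z, ρ z) = 1

/-- `u` admits the blow-up `v` at `x₀`:
`∫_{B₁} ‖u (x₀ + ℓ z) - v z‖ dz → 0` as `ℓ → 0⁺`. -/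
def HasBlowUp {d : ℕ} {F : Type*} [NormedAddCommGroup F]
    (u : EuclideanSpace ℝ (Fin d) → F) (x₀ : EuclideanSpace ℝ (Fin d))
    (v : EuclideanSpace ℝ (Fin d) → F) : Prop :=
  Filter.Tendsto (fun ℓ : ℝ => ∫ z in Metric.ball (0 : EuclideanSpace ℝ (Fin d)) 1,
      ‖u (x₀ + ℓ • z) - v z‖) (𝓝[>] (0:ℝ)) (𝓝 0)

/-- The mollification `(u ∗ ρ_ℓ)(x) = ∫ ρ_ℓ(y) u (x - y) dy`, with
`ρ_ℓ(y) = ℓ^{-d} ρ(y/ℓ)`. -/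
noncomputable def mollify {d : ℕ} {F : Type*} [NormedAddCommGroup F] [NormedSpace ℝ F]
    [CompleteSpace F]
    (ρ : EuclideanSpace ℝ (Fin d) → ℝ) (u : EuclideanSpace ℝ (Fin d) → F) (ℓ : ℝ)
    (x : EuclideanSpace ℝ (Fin d)) : F :=
  ∫ y, ((ℓ ^ d)⁻¹ * ρ (ℓ⁻¹ • y)) • u (x - y)

/-- The jump blow-up profile `v(z) = u⁺ 1_{⟨z,ν⟩ ≥ 0}(z) + u⁻ 1_{⟨z,ν⟩ < 0}(z)`. -/
def jumpFn {d : ℕ} {F : Type*} (up um : F) (ν : EuclideanSpace ℝ (Fin d)) :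
    EuclideanSpace ℝ (Fin d) → F :=
  fun z => if 0 ≤ ⟪z, ν⟫ then up else um

/-- The tensor product `(a ⊗ b)_{ij} = aᵢ bⱼ`, as a `d × d` real matrix. -/
def tensor {d : ℕ} (a b : EuclideanSpace ℝ (Fin d)) : Fin d → Fin d → ℝ :=
  fun i j => a i * b j

/-- `α_ν(y) = ∫_{B₁(y) ∩ {⟨z,ν⟩ ≥ 0}} ρ(y - z) dz`. -/
noncomputable def alphaNu {d : ℕ} (ρ : EuclideanSpace ℝ (Fin d) → ℝ)
    (ν : EuclideanSpace ℝ (Fin d)) (y : EuclideanSpace ℝ (Fin d)) : ℝ :=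
  ∫ z in Metric.ball y 1 ∩ {z | 0 ≤ ⟪z, ν⟫}, ρ (y - z)

namespace IsKernel

variable {d : ℕ} {ρ : EuclideanSpace ℝ (Fin d) → ℝ}

lemma continuous (hρ : IsKernel d ρ) : Continuous ρ := hρ.smooth.continuous

lemma hasCompactSupport (hρ : IsKernel d ρ) : HasCompactSupport ρ :=
  HasCompactSupport.of_support_subset_isCompact (isCompact_closedBall 0 1)
    ((subset_tsupport ρ).trans (hρ.supp.trans ball_subset_closedBall))

lemma integrable (hρ : IsKernel d ρ) : Integrable ρ :=
  hρ.continuous.integrable_of_hasCompactSupport hρ.hasCompactSupport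

lemma eq_zero_of_notMem_ball (hρ : IsKernel d ρ) {z : EuclideanSpace ℝ (Fin d)}
    (hz : z ∉ ball (0 : EuclideanSpace ℝ (Fin d)) 1) : ρ z = 0 :=
  image_eq_zero_of_notMem_tsupport fun h => hz (hρ.supp h)

/-- Multiplying a bounded measurable field by a kernel gives an integrable field. -/
lemma integrable_smul {F : Type*} [NormedAddCommGroup F] [NormedSpace ℝ F]
    (hρ : IsKernel d ρ) {f : EuclideanSpace ℝ (Fin d) → F} (hf : AEStronglyMeasurable f)
    {C : ℝ} (hC : ∀ x, ‖f x‖ ≤ C) : Integrable fun z => ρ z • f z :=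
  hρ.integrable.smul_bdd C hf (ae_of_all _ hC)

end IsKernel

section Mollify

variable {d : ℕ} {F : Type*} [NormedAddCommGroup F] [NormedSpace ℝ F] [CompleteSpace F]

lemma mollify_eq_integral (ρ : EuclideanSpace ℝ (Fin d) → ℝ) (f : EuclideanSpace ℝ (Fin d) → F)
    {ℓ : ℝ} (hℓ : 0 < ℓ) (x : EuclideanSpace ℝ (Fin d)) :
    mollify ρ f ℓ x = ∫ z, ρ z • f (x - ℓ • z) := by
  have h := Measure.integral_comp_inv_smul_of_nonneg
    (volume : Measure (EuclideanSpace ℝ (Fin d))) (fun z => ρ z • f (x - ℓ • z)) hℓ.le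
  simp only [smul_inv_smul₀ hℓ.ne', finrank_euclideanSpace, Fintype.card_fin] at h
  simp only [mollify, mul_smul]
  rw [integral_smul, h, inv_smul_smul₀ (pow_ne_zero d hℓ.ne')]

/-- The mollification at scale `ℓ`, seen in blow-up coordinates. -/
lemma mollify_blowUp_eq_integral (ρ : EuclideanSpace ℝ (Fin d) → ℝ)
    (f : EuclideanSpace ℝ (Fin d) → F) {ℓ : ℝ} (hℓ : 0 < ℓ) (x₀ y : EuclideanSpace ℝ (Fin d)) :
    mollify ρ f ℓ (x₀ + ℓ • y) = ∫ z, ρ z • f (x₀ + ℓ • (y - z)) := by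
  rw [mollify_eq_integral ρ f hℓ]
  simp only [smul_sub, add_sub_assoc]

lemma mollify_eq_integral_of_even {ρ : EuclideanSpace ℝ (Fin d) → ℝ} (hρ : ∀ z, ρ (-z) = ρ z)
    (f : EuclideanSpace ℝ (Fin d) → F) {ℓ : ℝ} (hℓ : 0 < ℓ) (x : EuclideanSpace ℝ (Fin d)) :
    mollify ρ f ℓ x = ∫ z, ρ z • f (x + ℓ • z) := by
  rw [mollify_eq_integral ρ f hℓ, ← integral_neg_eq_self]
  simp only [hρ, smul_neg, sub_neg_eq_add]

end Mollify

section Jump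

variable {d : ℕ} {F : Type*}

lemma jumpFn_smul (up um : F) (ν : EuclideanSpace ℝ (Fin d)) {r : ℝ} (hr : 0 < r)
    (z : EuclideanSpace ℝ (Fin d)) : jumpFn up um ν (r • z) = jumpFn up um ν z := by
  simp only [jumpFn, real_inner_smul_left, mul_nonneg_iff_of_pos_left hr]

lemma measurableSet_halfSpace (ν : EuclideanSpace ℝ (Fin d)) :
    MeasurableSet {z : EuclideanSpace ℝ (Fin d) | 0 ≤ ⟪z, ν⟫} :=
  measurableSet_le measurable_const (by fun_prop)

lemma stronglyMeasurable_jumpFn [TopologicalSpace F] (up um : F)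
    (ν : EuclideanSpace ℝ (Fin d)) : StronglyMeasurable (jumpFn up um ν) :=
  StronglyMeasurable.ite (measurableSet_halfSpace ν) stronglyMeasurable_const
    stronglyMeasurable_const

lemma norm_jumpFn_le [NormedAddCommGroup F] (up um : F) (ν z : EuclideanSpace ℝ (Fin d)) :
    ‖jumpFn up um ν z‖ ≤ max ‖up‖ ‖um‖ := by
  unfold jumpFn
  split_ifs
  exacts [le_max_left _ _, le_max_right _ _]

lemma alphaNu_eq_integral {ρ : EuclideanSpace ℝ (Fin d) → ℝ} (hρ : IsKernel d ρ)
    (ν y : EuclideanSpace ℝ (Fin d)) :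
    alphaNu ρ ν y = ∫ z, ρ z * jumpFn (1 : ℝ) 0 ν (y - z) := by
  rw [← integral_sub_left_eq_self _ volume y, alphaNu,
    ← integral_indicator (measurableSet_ball.inter (measurableSet_halfSpace ν))]
  refine integral_congr_ae (ae_of_all _ fun z => ?_)
  by_cases hz : z ∈ ball y 1
  · by_cases hn : 0 ≤ ⟪z, ν⟫ <;> simp [indicator, jumpFn, hn, mem_ball.mp hz]
  · have h0 : ρ (y - z) = 0 := hρ.eq_zero_of_notMem_ball (by
      simpa [dist_eq_norm, norm_sub_rev] using hz)
    simp [indicator, h0]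

/-- Convolving the jump profile with a kernel interpolates between the two traces. -/
lemma integral_smul_jumpFn [NormedAddCommGroup F] [NormedSpace ℝ F] [CompleteSpace F]
    {ρ : EuclideanSpace ℝ (Fin d) → ℝ} (hρ : IsKernel d ρ)
    (up um : F) (ν y : EuclideanSpace ℝ (Fin d)) :
    ∫ z, ρ z • jumpFn up um ν (y - z) =
      alphaNu ρ ν y • up + (1 - alphaNu ρ ν y) • um := by
  have hj : Integrable fun z => ρ z * jumpFn (1 : ℝ) 0 ν (y - z) :=
    hρ.integrable_smul
      ((stronglyMeasurable_jumpFn _ _ ν).comp_measurable (by fun_prop)).aestronglyMeasurable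
      fun z => norm_jumpFn_le 1 0 ν (y - z)
  have h : ∀ z, ρ z • jumpFn up um ν (y - z) =
      (ρ z * jumpFn (1 : ℝ) 0 ν (y - z)) • (up - um) + ρ z • um := by
    intro z
    unfold jumpFn
    split_ifs <;> simp [smul_sub]
  simp only [h]
  rw [integral_add (hj.smul_const _) (hρ.integrable.smul_const _), integral_smul_const,
    integral_smul_const, hρ.mass, ← alphaNu_eq_integral hρ]
  module

/-- A jump blow-up on the unit ball is also a blow-up on every centred ball. -/
lemma HasBlowUp.tendsto_setIntegral_ball [NormedAddCommGroup F]
    {u : EuclideanSpace ℝ (Fin d) → F} {x₀ : EuclideanSpace ℝ (Fin d)} {up um : F}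
    {ν : EuclideanSpace ℝ (Fin d)} (h : HasBlowUp u x₀ (jumpFn up um ν)) {r : ℝ} (hr : 0 < r) :
    Tendsto (fun ℓ : ℝ => ∫ z in ball (0 : EuclideanSpace ℝ (Fin d)) r,
      ‖u (x₀ + ℓ • z) - jumpFn up um ν z‖) (𝓝[>] (0 : ℝ)) (𝓝 0) := by
  have hscale : Tendsto (fun ℓ : ℝ => ℓ * r) (𝓝[>] (0 : ℝ)) (𝓝[>] (0 : ℝ)) := by
    refine tendsto_nhdsWithin_iff.mpr ⟨?_, ?_⟩
    · exact ((continuous_mul_const r).tendsto' 0 0 (zero_mul r)).mono_left nhdsWithin_le_nhds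
    · filter_upwards [self_mem_nhdsWithin] with ℓ hℓ using mul_pos hℓ hr
  have h2 := (h.comp hscale).const_mul (r ^ d)
  rw [mul_zero] at h2
  refine h2.congr fun ℓ => ?_
  have hs := Measure.setIntegral_comp_smul_of_pos
    (volume : Measure (EuclideanSpace ℝ (Fin d)))
    (fun z => ‖u (x₀ + ℓ • z) - jumpFn up um ν z‖) (ball 0 1) hr
  simp only [smul_smul, jumpFn_smul up um ν hr, smul_unitBall_of_pos hr,
    finrank_euclideanSpace, Fintype.card_fin, smul_eq_mul] at hs
  simp only [Function.comp_apply, hs]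
  exact mul_inv_cancel_left₀ (pow_ne_zero d hr.ne') _

/-- Mollifications converge, in blow-up coordinates, to the convolution of the jump profile. -/
lemma HasBlowUp.tendsto_mollify [NormedAddCommGroup F] [NormedSpace ℝ F] [CompleteSpace F]
    {u : EuclideanSpace ℝ (Fin d) → F} (hu : StronglyMeasurable u) {C : ℝ}
    (hC : ∀ x, ‖u x‖ ≤ C) {x₀ : EuclideanSpace ℝ (Fin d)} {up um : F}
    {ν : EuclideanSpace ℝ (Fin d)} (h : HasBlowUp u x₀ (jumpFn up um ν))
    {ρ : EuclideanSpace ℝ (Fin d) → ℝ} (hρ : IsKernel d ρ) {y : EuclideanSpace ℝ (Fin d)}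
    (hy : y ∈ ball (0 : EuclideanSpace ℝ (Fin d)) 1) :
    Tendsto (fun ℓ : ℝ => mollify ρ u ℓ (x₀ + ℓ • y)) (𝓝[>] (0 : ℝ))
      (𝓝 (alphaNu ρ ν y • up + (1 - alphaNu ρ ν y) • um)) := by
  obtain ⟨M, hM⟩ := hρ.hasCompactSupport.exists_bound_of_continuous hρ.continuous
  have hlim := (h.tendsto_setIntegral_ball zero_lt_two).const_mul M
  rw [mul_zero] at hlim
  rw [tendsto_iff_norm_sub_tendsto_zero]
  refine squeeze_zero' (Eventually.of_forall fun _ => norm_nonneg _) ?_ hlim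
  filter_upwards [self_mem_nhdsWithin] with ℓ hℓ
  have hmeas : StronglyMeasurable fun w : EuclideanSpace ℝ (Fin d) =>
      u (x₀ + ℓ • w) - jumpFn up um ν w :=
    (hu.comp_measurable (by fun_prop)).sub (stronglyMeasurable_jumpFn up um ν)
  have hbd : ∀ w : EuclideanSpace ℝ (Fin d),
      ‖u (x₀ + ℓ • w) - jumpFn up um ν w‖ ≤ C + max ‖up‖ ‖um‖ := fun w =>
    (norm_sub_le _ _).trans (add_le_add (hC _) (norm_jumpFn_le up um ν w))
  have hball : IntegrableOn (fun w : EuclideanSpace ℝ (Fin d) =>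
      ‖u (x₀ + ℓ • w) - jumpFn up um ν w‖) (ball 0 2) :=
    (IntegrableOn.of_bound measure_ball_lt_top hmeas.aestronglyMeasurable _
      (ae_of_all _ hbd)).norm
  have hintu : Integrable fun z => ρ z • u (x₀ + ℓ • (y - z)) :=
    hρ.integrable_smul (hu.comp_measurable (by fun_prop)).aestronglyMeasurable fun z => hC _
  have hintj : Integrable fun z => ρ z • jumpFn up um ν (y - z) :=
    hρ.integrable_smul ((stronglyMeasurable_jumpFn up um ν).comp_measurable
      (by fun_prop)).aestronglyMeasurable fun z => norm_jumpFn_le up um ν (y - z)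
  rw [mollify_blowUp_eq_integral ρ u hℓ, ← integral_smul_jumpFn hρ, ← integral_sub hintu hintj,
    ← integral_sub_left_eq_self _ volume y, ← integral_const_mul,
    ← integral_indicator measurableSet_ball]
  refine norm_integral_le_of_norm_le
    (IntegrableOn.integrable_indicator (hball.const_mul M) measurableSet_ball)
    (ae_of_all _ fun w => ?_)
  simp only [sub_sub_cancel, ← smul_sub, norm_smul]
  by_cases hw : w ∈ ball (0 : EuclideanSpace ℝ (Fin d)) 2
  · rw [indicator_of_mem hw]
    exact mul_le_mul_of_nonneg_right (hM _) (norm_nonneg _)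
  · rw [indicator_of_notMem hw, hρ.eq_zero_of_notMem_ball, norm_zero, zero_mul]
    rw [mem_ball_zero_iff] at hy hw ⊢
    intro hyw
    have := norm_sub_le y (y - w)
    rw [sub_sub_cancel] at this
    linarith

end Jump

section Tensor

variable {d : ℕ}

lemma continuous_tensor_self :
    Continuous fun a : EuclideanSpace ℝ (Fin d) => tensor a a := by
  unfold tensor
  fun_prop

lemma norm_tensor_le (a b : EuclideanSpace ℝ (Fin d)) : ‖tensor a b‖ ≤ ‖a‖ * ‖b‖ := by
  have h : 0 ≤ ‖a‖ * ‖b‖ := by positivity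
  refine (pi_norm_le_iff_of_nonneg h).mpr fun i => (pi_norm_le_iff_of_nonneg h).mpr fun j => ?_
  rw [tensor, norm_mul]
  exact mul_le_mul (PiLp.norm_apply_le a i) (PiLp.norm_apply_le b j) (norm_nonneg _)
    (norm_nonneg _)

end Tensor

/-- If `u ∈ L^∞` admits at `x₀` the jump blow-up with data `(u⁺, u⁻, ν)` (with `u⁺ = u⁻`
allowed) and `ρ ∈ K` is radial, then, writing `u_ℓ = u ∗ ρ_ℓ`,
`((u_ℓ ⊗ u_ℓ) ∗ ρ_ℓ)(x₀) → ∫_{B₁} [α_ν(y) u⁺ + (1 - α_ν(y)) u⁻]⊗[α_ν(y) u⁺ + (1 - α_ν(y)) u⁻] ρ(y) dy`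
as `ℓ → 0⁺`. -/
theorem statement9 {d : ℕ} (u : EuclideanSpace ℝ (Fin d) → EuclideanSpace ℝ (Fin d))
    (hmeas : Measurable u) (hbd : ∃ C, ∀ x, ‖u x‖ ≤ C)
    (x₀ : EuclideanSpace ℝ (Fin d))
    (up um : EuclideanSpace ℝ (Fin d)) (ν : EuclideanSpace ℝ (Fin d)) (hν : ‖ν‖ = 1)
    (hblow : HasBlowUp u x₀ (jumpFn up um ν))
    (ρ : EuclideanSpace ℝ (Fin d) → ℝ) (hρ : IsKernel d ρ)
    (hrad : ∃ g : ℝ → ℝ, ∀ z, ρ z = g ‖z‖) :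
    Tendsto (fun ℓ : ℝ =>
        mollify ρ (fun x => tensor (mollify ρ u ℓ x) (mollify ρ u ℓ x)) ℓ x₀)
      (𝓝[>] (0:ℝ))
      (𝓝 (∫ y in Metric.ball (0 : EuclideanSpace ℝ (Fin d)) 1,
            ρ y • tensor (alphaNu ρ ν y • up + (1 - alphaNu ρ ν y) • um)
              (alphaNu ρ ν y • up + (1 - alphaNu ρ ν y) • um))) := by
  obtain ⟨C, hC⟩ := hbd
  have hu : StronglyMeasurable u := hmeas.stronglyMeasurable
  have hUmeas : ∀ ℓ : ℝ, 0 < ℓ → StronglyMeasurable fun y => mollify ρ u ℓ (x₀ + ℓ • y) := by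
    intro ℓ hℓ
    simp only [mollify_blowUp_eq_integral ρ u hℓ]
    refine StronglyMeasurable.integral_prod_right (f := fun y z => ρ z • u (x₀ + ℓ • (y - z))) ?_
    exact (hρ.continuous.stronglyMeasurable.comp_measurable measurable_snd).smul
      (hu.comp_measurable (by fun_prop))
  have hUbd : ∀ ℓ : ℝ, 0 < ℓ → ∀ y, ‖mollify ρ u ℓ (x₀ + ℓ • y)‖ ≤ ∫ z, ‖ρ z‖ * C := by
    intro ℓ hℓ y
    rw [mollify_blowUp_eq_integral ρ u hℓ]
    refine norm_integral_le_of_norm_le (hρ.integrable.norm.mul_const C) (ae_of_all _ fun z => ?_)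
    rw [norm_smul]
    exact mul_le_mul_of_nonneg_left (hC _) (norm_nonneg _)
  set K := ∫ z, ‖ρ z‖ * C
  rw [setIntegral_eq_integral_of_forall_compl_eq_zero fun y hy => by
    rw [hρ.eq_zero_of_notMem_ball hy, zero_smul]]
  have hDCT := tendsto_integral_filter_of_dominated_convergence (μ := volume)
    (l := 𝓝[>] (0 : ℝ))
    (F := fun ℓ y => ρ y • tensor (mollify ρ u ℓ (x₀ + ℓ • y)) (mollify ρ u ℓ (x₀ + ℓ • y)))
    (f := fun y => ρ y • tensor (alphaNu ρ ν y • up + (1 - alphaNu ρ ν y) • um)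
      (alphaNu ρ ν y • up + (1 - alphaNu ρ ν y) • um))
    (fun y => ‖ρ y‖ * (K * K)) ?_ ?_ (hρ.integrable.norm.mul_const _) ?_
  · refine hDCT.congr' ?_
    filter_upwards [self_mem_nhdsWithin] with ℓ hℓ
    rw [mollify_eq_integral_of_even hρ.even _ hℓ]
  · filter_upwards [self_mem_nhdsWithin] with ℓ hℓ
    exact (hρ.continuous.stronglyMeasurable.smul
      (continuous_tensor_self.comp_stronglyMeasurable (hUmeas ℓ hℓ))).aestronglyMeasurable
  · filter_upwards [self_mem_nhdsWithin] with ℓ hℓ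
    refine ae_of_all _ fun y => ?_
    rw [norm_smul]
    have hK := hUbd ℓ hℓ y
    exact mul_le_mul_of_nonneg_left ((norm_tensor_le _ _).trans
      (mul_le_mul hK hK (norm_nonneg _) ((norm_nonneg _).trans hK))) (norm_nonneg _)
  · refine ae_of_all _ fun y => ?_
    by_cases hy : y ∈ ball (0 : EuclideanSpace ℝ (Fin d)) 1
    · exact ((continuous_tensor_self.tendsto _).comp
        (hblow.tendsto_mollify hu hC hρ hy)).const_smul (ρ y)
    · simp only [hρ.eq_zero_of_notMem_ball hy, zero_smul]
      exact tendsto_const_nhds
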